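/- arXiv:2306.12933 — 2 statements merged into one kernel-verified Lean document; each statement's English description precedes it below -/
import Mathlib

section
/- Let 0 < δ < 1/2, let ‖·‖ be a norm on ℝⁿ, let B = B_‖·‖(x,r) be a closed ball, and let f : B → ℝⁿ be a continuous function such that ‖f(y) − y‖ ≤ δr for all y in the boundary ∂B. Then f(B) ⊇ B_‖·‖(x,(1−δ)r). -/
open Set Filter Topology MeasureTheory Metric

theorem exists_sum_mul_det_one_add_smul_eq {E : Type*} [NormedAddCommGroup E] [NormedSpace ℝ E]
    [FiniteDimensional ℝ E] (t : ℕ → ℝ) (ht : Function.Injective t) :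
    ∃ (s : Finset ℕ) (a : ℕ → ℝ), ∑ i ∈ s, a i = 1 ∧
      ∀ A : E →L[ℝ] E, ∑ i ∈ s, a i * (1 + t i • A).det = (1 + A).det := by
  set d := Module.finrank ℝ E
  set s := Finset.range (d + 1)
  have hs : InjOn t s := ht.injOn
  refine ⟨s, fun i => (Lagrange.basis s t i).eval 1, ?_, fun A => ?_⟩
  · rw [← Polynomial.eval_finsetSum, Lagrange.sum_basis hs (by simp [s]), Polynomial.eval_one]
  · let b := Module.finBasis ℝ E
    let M := LinearMap.toMatrix b b (A : E →ₗ[ℝ] E)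
    let p : Polynomial ℝ :=
      ((Polynomial.X : Polynomial ℝ) • M.map Polynomial.C +
        (1 : Matrix (Fin d) (Fin d) ℝ).map Polynomial.C).det
    have hp (u : ℝ) : p.eval u = (1 + u • A).det := by
      rw [ContinuousLinearMap.det, ← LinearMap.det_toMatrix b, ← Polynomial.coe_evalRingHom,
        RingHom.map_det]
      congr 1
      ext i j
      by_cases hij : i = j
      · subst hij
        simp [M, LinearMap.toMatrix_apply, add_comm (1 : ℝ), mul_comm u]
      · simp [M, LinearMap.toMatrix_apply, hij, mul_comm u]
    have hdeg : p.degree < s.card := by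
      refine Polynomial.degree_le_natDegree.trans_lt ?_
      have := Polynomial.natDegree_det_X_add_C_le M 1
      simp only [Fintype.card_fin] at this
      simp only [s, Finset.card_range]
      exact_mod_cast Nat.lt_succ_of_le this
    have h := congrArg (Polynomial.eval 1) (Lagrange.eq_interpolate hs hdeg)
    rw [Lagrange.interpolate_apply, Polynomial.eval_finsetSum, hp] at h
    simp only [one_smul, Polynomial.eval_mul, Polynomial.eval_C, hp] at h
    rw [h]
    exact Finset.sum_congr rfl fun i _ => mul_comm _ _

theorem exists_pos_forall_norm_lt_det_one_add_pos {E : Type*} [NormedAddCommGroup E]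
    [NormedSpace ℝ E] [FiniteDimensional ℝ E] :
    ∃ ε > 0, ∀ A : E →L[ℝ] E, ‖A‖ < ε → 0 < (1 + A).det := by
  have hc : Continuous fun A : E →L[ℝ] E => (1 + A).det :=
    ContinuousLinearMap.continuous_det.comp (continuous_const.add continuous_id)
  have h0 : ∀ᶠ A in 𝓝 (0 : E →L[ℝ] E), 0 < (1 + A).det := by
    refine hc.continuousAt.eventually (lt_mem_nhds ?_)
    have : (1 : E →L[ℝ] E).det = 1 := LinearMap.det_id
    simp [this]
  obtain ⟨ε, hε, h⟩ := Metric.eventually_nhds_iff.1 h0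
  exact ⟨ε, hε, fun A hA => h (by simpa using hA)⟩

theorem LipschitzOnWith.indicator_closedBall {E F : Type*} [NormedAddCommGroup E]
    [NormedSpace ℝ E] [NormedAddCommGroup F] {h : E → F} {K : NNReal} {R : ℝ}
    (hK : LipschitzOnWith K h (closedBall 0 R)) (hS : ∀ x, ‖x‖ = R → h x = 0) :
    LipschitzWith K ((closedBall 0 R).indicator h) := by
  have key (x y : E) (hx : x ∈ closedBall 0 R) (hy : y ∉ closedBall 0 R) :
      ‖h x‖ ≤ K * ‖x - y‖ := by
    have hc : ContinuousOn (fun s : ℝ => ‖x + s • (y - x)‖) (Icc 0 1) := by fun_prop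
    simp only [mem_closedBall, dist_zero_right, not_le] at hx hy
    obtain ⟨s, hs, hsR⟩ := intermediate_value_Icc zero_le_one hc
      (show R ∈ Icc _ _ by simpa using ⟨hx, hy.le⟩)
    have := hK.norm_sub_le (x := x) (y := x + s • (y - x)) (by simpa using hx)
      (by simpa using hsR.le)
    rw [hS _ hsR, sub_zero] at this
    refine this.trans ?_
    gcongr
    rw [sub_add_cancel_left, norm_neg, norm_smul, norm_sub_rev y x, Real.norm_of_nonneg hs.1]
    exact mul_le_of_le_one_left (norm_nonneg _) hs.2
  refine LipschitzWith.of_dist_le_mul fun x y => ?_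
  rw [dist_eq_norm, dist_eq_norm]
  by_cases hx : x ∈ closedBall 0 R <;> by_cases hy : y ∈ closedBall 0 R
  · simpa [hx, hy] using hK.norm_sub_le hx hy
  · simpa only [indicator_of_mem hx, indicator_of_notMem hy, sub_zero] using key x y hx hy
  · simpa only [indicator_of_mem hy, indicator_of_notMem hx, zero_sub, norm_neg, norm_sub_rev]
      using key y x hy hx
  · rw [indicator_of_notMem hx, indicator_of_notMem hy, sub_zero, norm_zero]
    positivity

theorem exists_pos_forall_setIntegral_det_one_add_smul_fderiv {E : Type*} [NormedAddCommGroup E]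
    [NormedSpace ℝ E] [FiniteDimensional ℝ E] [MeasurableSpace E] [BorelSpace E]
    (μ : Measure E) [μ.IsAddHaarMeasure] {h : E → E} {R : ℝ} (hh : ContDiff ℝ 1 h)
    (hS : ∀ x, ‖x‖ = R → h x = 0) :
    ∃ τ > (0 : ℝ), ∀ t : ℝ, 0 < t → t < τ →
      ∫ x in closedBall 0 R, (1 + t • fderiv ℝ h x).det ∂μ = μ.real (closedBall 0 R) := by
  obtain ⟨ε, hε, hdet⟩ := exists_pos_forall_norm_lt_det_one_add_pos (E := E)
  obtain ⟨C, hC⟩ := (isCompact_closedBall (0 : E) R).exists_bound_of_continuousOn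
    (hh.continuous_fderiv one_ne_zero).continuousOn
  set K : NNReal := C.toNNReal + 1
  have hKC : ∀ x ∈ closedBall (0 : E) R, ‖fderiv ℝ h x‖ ≤ K := fun x hx =>
    (hC x hx).trans ((Real.le_coe_toNNReal C).trans (by simp [K]))
  have hKpos : (0 : ℝ) < K := by positivity
  have hlip : LipschitzOnWith K h (closedBall 0 R) :=
    (convex_closedBall 0 R).lipschitzOnWith_of_nnnorm_fderiv_le
      (fun x _ => hh.differentiable one_ne_zero x) (fun x hx => hKC x hx)
  have hLip := hlip.indicator_closedBall hS
  refine ⟨min (ε / K) (1 / K), by positivity, fun t ht0 ht => ?_⟩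
  have ht1 : t * K < ε := (lt_div_iff₀ hKpos).1 (ht.trans_le (min_le_left _ _))
  have ht2 : t * K < 1 := (lt_div_iff₀ hKpos).1 (ht.trans_le (min_le_right _ _))
  let F : E → E := fun x => x + t • (closedBall 0 R).indicator h x
  have hF : ApproximatesLinearOn F ((ContinuousLinearEquiv.refl ℝ E : E ≃L[ℝ] E) : E →L[ℝ] E)
      univ (t.toNNReal * K) := by
    rw [ApproximatesLinearOn.approximatesLinearOn_iff_lipschitzOnWith, lipschitzOnWith_univ]
    refine LipschitzWith.of_dist_le_mul fun x y => ?_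
    simp only [F, Pi.sub_apply, ContinuousLinearEquiv.coe_coe, ContinuousLinearEquiv.refl_apply,
      add_sub_cancel_left, dist_smul₀, NNReal.coe_mul, Real.coe_toNNReal _ ht0.le,
      Real.norm_of_nonneg ht0.le, mul_assoc]
    gcongr
    exact hLip.dist_le_mul x y
  have hc : Subsingleton E ∨
      t.toNNReal * K < ‖((ContinuousLinearEquiv.refl ℝ E).symm : E →L[ℝ] E)‖₊⁻¹ := by
    rcases subsingleton_or_nontrivial E with hE | hE
    · exact Or.inl hE
    · right
      have : ‖((ContinuousLinearEquiv.refl ℝ E).symm : E →L[ℝ] E)‖₊ = 1 := by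
        ext; exact ContinuousLinearMap.norm_id
      rw [this, inv_one, ← NNReal.coe_lt_coe]
      simpa [ht0.le] using ht2
  have hout (x : E) (hx : x ∉ closedBall 0 R) : F x = x := by
    simp only [F, indicator_of_notMem hx, smul_zero, add_zero]
  have hin (x : E) (hx : x ∈ closedBall 0 R) : F x = x + t • h x := by
    simp only [F, indicator_of_mem hx]
  have hinj : Function.Injective F := injOn_univ.1 (hF.injOn hc)
  have himg : F '' closedBall 0 R = closedBall 0 R := by
    ext y
    constructor
    · rintro ⟨x, hx, rfl⟩
      by_contra hy
      exact hy (by rwa [hinj (hout _ hy)])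
    · intro hy
      obtain ⟨x, rfl⟩ := hF.surjective hc y
      refine ⟨x, ?_, rfl⟩
      by_contra hx
      exact hx (by rwa [hout x hx] at hy)
  have hder : ∀ x ∈ closedBall (0 : E) R, HasFDerivWithinAt F (1 + t • fderiv ℝ h x)
      (closedBall 0 R) x := fun x hx => by
    refine HasFDerivWithinAt.congr ?_ hin (hin x hx)
    exact ((hasFDerivAt_id x).add
      ((hh.differentiable one_ne_zero x).hasFDerivAt.const_smul t)).hasFDerivWithinAt
  have hcv := integral_image_eq_integral_abs_det_fderiv_smul μ measurableSet_closedBall hder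
    hinj.injOn (fun _ => (1 : ℝ))
  rw [himg] at hcv
  simp only [smul_eq_mul, mul_one, setIntegral_const] at hcv
  rw [hcv]
  refine setIntegral_congr_fun measurableSet_closedBall fun x hx => (abs_of_pos (hdet _ ?_)).symm
  rw [norm_smul, Real.norm_of_nonneg ht0.le]
  exact (mul_le_mul_of_nonneg_left (hKC x hx) ht0.le).trans_lt ht1

theorem not_contDiff_retraction_sphere {E : Type*} [NormedAddCommGroup E] [InnerProductSpace ℝ E]
    [FiniteDimensional ℝ E] {g : E → E} {R : ℝ} (hR : 0 < R) (hg : ContDiff ℝ 1 g)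
    (hS : ∀ x, ‖x‖ = R → g x = x) (hgS : ∀ x, ‖x‖ ≤ R → ‖g x‖ = R) : False := by
  let _ : MeasurableSpace E := borel E
  have : BorelSpace E := ⟨rfl⟩
  let μ : Measure E := Measure.addHaar
  have hh : ContDiff ℝ 1 (fun x => g x - x) := hg.sub contDiff_id
  obtain ⟨τ, hτ, hint⟩ := exists_pos_forall_setIntegral_det_one_add_smul_fderiv μ hh
    (R := R) (fun x hx => by simp [hS x hx])
  obtain ⟨s, a, ha, hdet⟩ := exists_sum_mul_det_one_add_smul_eq (E := E)
    (fun n : ℕ => τ / (n + 2)) (fun m n hmn => by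
      have : (m : ℝ) + 2 = n + 2 := by
        field_simp at hmn
        linarith
      exact_mod_cast add_right_cancel this)
  have hfd (x : E) : 1 + fderiv ℝ (fun x => g x - x) x = fderiv ℝ g x := by
    rw [fderiv_fun_sub (hg.differentiable one_ne_zero x) differentiableAt_fun_id, fderiv_fun_id]
    exact add_sub_cancel _ _
  have hcont (t : ℝ) : Continuous fun x => (1 + t • fderiv ℝ (fun x => g x - x) x).det :=
    ContinuousLinearMap.continuous_det.comp
      (continuous_const.add ((hh.continuous_fderiv one_ne_zero).const_smul t))
  have h1 : ∫ x in closedBall 0 R, (fderiv ℝ g x).det ∂μ = μ.real (closedBall 0 R) := by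
    rw [funext fun x => show (fderiv ℝ g x).det = _ by rw [← hfd, ← hdet]]
    rw [integral_finsetSum _ fun i _ => ?_]
    · simp_rw [integral_const_mul]
      rw [← one_mul (μ.real _), ← ha, Finset.sum_mul]
      refine Finset.sum_congr rfl fun i _ => ?_
      rw [hint _ (by positivity)]
      exact div_lt_self hτ (by linarith [Nat.cast_nonneg (α := ℝ) i])
    · exact ((hcont _).continuousOn.integrableOn_compact
        (isCompact_closedBall 0 R)).const_mul _
  have h2 : ∫ x in ball 0 R, (fderiv ℝ g x).det ∂μ = 0 := by
    refine setIntegral_eq_zero_of_forall_eq_zero fun x hx => ?_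
    by_contra hne
    have hsurj : Function.Surjective (fderiv ℝ g x) :=
      ((fderiv ℝ g x : E →ₗ[ℝ] E).equivOfDetNeZero hne).surjective
    obtain ⟨v, hv⟩ := hsurj (g x)
    have hconst : (fun y => inner ℝ (g y) (g y)) =ᶠ[𝓝 x] fun _ => R ^ 2 := by
      filter_upwards [isOpen_ball.mem_nhds hx] with y hy
      rw [real_inner_self_eq_norm_sq, hgS y (by simpa using (mem_ball.1 hy).le)]
    have hd := (hg.differentiable one_ne_zero x).hasFDerivAt
    have h0 := (hd.inner ℝ hd).unique ((hasFDerivAt_const (R ^ 2) x).congr_of_eventuallyEq hconst)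
    have := congrArg (fun L : E →L[ℝ] ℝ => L v) h0
    simp [hv, hgS x (by simpa using (mem_ball.1 hx).le)] at this
    exact hR.ne' this
  have hae : closedBall (0 : E) R =ᵐ[μ] ball 0 R := by
    rw [← ball_union_sphere]
    exact union_ae_eq_left_of_ae_eq_empty
      (ae_eq_empty.2 (Measure.addHaar_sphere_of_ne_zero μ 0 hR.ne'))
  rw [setIntegral_congr_set hae, h2] at h1
  exact (ENNReal.toReal_pos (measure_closedBall_pos μ 0 hR).ne'
    measure_closedBall_lt_top.ne).ne h1

theorem exists_eq_zero_of_eq_self_of_le_norm {E : Type*} [NormedAddCommGroup E]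
    [InnerProductSpace ℝ E] [FiniteDimensional ℝ E] {F : E → E} {R : ℝ} (hF : Continuous F)
    (hR : ∀ x, R ≤ ‖x‖ → F x = x) : ∃ x, F x = 0 := by
  by_contra! hne
  set r := max R 0
  have hr : 0 < r + 1 := by positivity
  have hFr : ∀ x, r < ‖x‖ → F x = x := fun x hx => hR x ((le_max_left _ _).trans hx.le)
  have hU : {x : E | r < ‖x‖} ∈ 𝓝ˢ {x : E | r + 1 ≤ ‖x‖} :=
    (isOpen_lt continuous_const continuous_norm).mem_nhdsSet.2 fun x hx =>
      (lt_add_one r).trans_le hx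
  obtain ⟨G, hG, hGF, hGS, -⟩ := hF.exists_contDiff_approx_and_eqOn 1 hF.norm
    (fun x => norm_pos_iff.2 (hne x)) (isClosed_le continuous_const continuous_norm) hU
    (contDiffOn_id.congr hFr)
  have hG0 (x : E) : G x ≠ 0 := fun h0 => by simpa [h0] using hGF x
  refine not_contDiff_retraction_sphere hr
    (g := fun x => ((r + 1) / ‖G x‖) • G x) ?_ (fun x hx => ?_) fun x _ => ?_
  · exact (contDiff_const.div (hG.norm ℝ hG0) fun x => norm_ne_zero_iff.2 (hG0 x)).smul hG
  · have : G x = x := (hGS hx.ge).trans (hFr x (by linarith))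
    simp only [this, hx, div_self hr.ne', one_smul]
  · rw [norm_smul, norm_div, norm_norm, div_mul_cancel₀ _ (norm_ne_zero_iff.2 (hG0 x)),
      Real.norm_of_nonneg hr.le]

theorem surjective_of_eqOn_compl_isBounded {E : Type*} [NormedAddCommGroup E]
    [NormedSpace ℝ E] [FiniteDimensional ℝ E] {F : E → E} {s : Set E} (hF : Continuous F)
    (hs : Bornology.IsBounded s) (hFs : EqOn F id sᶜ) : Function.Surjective F := by
  intro z
  let e : E ≃L[ℝ] EuclideanSpace ℝ (Fin (Module.finrank ℝ E)) :=
    ContinuousLinearEquiv.ofFinrankEq (by simp)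
  let S : Set (EuclideanSpace ℝ (Fin (Module.finrank ℝ E))) := (fun x => e (x - z)) '' s
  have hS : Bornology.IsBounded S := by
    have hc : IsCompact ((fun x => e (x - z)) '' closure s) :=
      hs.isCompact_closure.image (by fun_prop)
    exact hc.isBounded.subset (image_mono subset_closure)
  obtain ⟨R, hR⟩ := hS.subset_ball 0
  obtain ⟨x, hx⟩ := exists_eq_zero_of_eq_self_of_le_norm (R := R)
    (F := fun x => e (F (e.symm x + z) - z)) (by fun_prop) fun x hx => by
      have : e.symm x + z ∈ sᶜ := fun hmem => by
        have := hR ⟨_, hmem, rfl⟩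
        simp at this
        linarith
      simp [hFs this]
  exact ⟨e.symm x + z, sub_eq_zero.1 (e.map_eq_zero_iff.1 hx)⟩

theorem Seminorm.continuous_of_finiteDimensional {E : Type*} [NormedAddCommGroup E]
    [NormedSpace ℝ E] [FiniteDimensional ℝ E] (N : Seminorm ℝ E) : Continuous N :=
  continuousOn_univ.1 (N.convexOn.continuousOn isOpen_univ)

theorem Seminorm.isBounded_le_of_eq_zero {E : Type*} [NormedAddCommGroup E]
    [NormedSpace ℝ E] [FiniteDimensional ℝ E] (N : Seminorm ℝ E) (hN : ∀ v, N v = 0 → v = 0)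
    (x : E) (c : ℝ) : Bornology.IsBounded {y | N (y - x) ≤ c} := by
  obtain ⟨m, hm, hmN⟩ : ∃ m > 0, ∀ v, ‖v‖ = 1 → m ≤ N v := by
    rcases (sphere (0 : E) 1).eq_empty_or_nonempty with h | h
    · exact ⟨1, one_pos, fun v hv => absurd (show v ∈ sphere (0 : E) 1 by simpa using hv)
        (by simp [h])⟩
    · obtain ⟨v, hv, hmin⟩ := (isCompact_sphere (0 : E) 1).exists_isMinOn h
        N.continuous_of_finiteDimensional.continuousOn
      refine ⟨N v, (apply_nonneg N v).lt_of_ne' fun h0 => ?_, fun w hw => hmin (by simpa using hw)⟩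
      simp [hN v h0] at hv
  have hbound (v : E) : m * ‖v‖ ≤ N v := by
    rcases eq_or_ne v 0 with rfl | hv
    · simp
    · have := hmN (‖v‖⁻¹ • v) (by simp [norm_smul, hv])
      rw [map_smul_eq_mul, norm_inv, norm_norm, inv_mul_eq_div,
        le_div_iff₀ (norm_pos_iff.2 hv)] at this
      exact this
  refine isBounded_closedBall (x := x) (r := c / m) |>.subset fun y hy => ?_
  rw [Metric.mem_closedBall, dist_eq_norm, le_div_iff₀ hm, mul_comm]
  exact (hbound _).trans hy

theorem Seminorm.mem_frontier_le_of_eq {E : Type*} [NormedAddCommGroup E] [NormedSpace ℝ E]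
    (N : Seminorm ℝ E) {x y : E} {r : ℝ} (hr : 0 < r) (hy : N (y - x) = r) :
    y ∈ frontier {w | N (w - x) ≤ r} := by
  refine ⟨subset_closure hy.le, fun hint => ?_⟩
  have hc : Tendsto (fun s : ℝ => x + s • (y - x)) (𝓝[>] 1) (𝓝 y) := by
    have : Continuous fun s : ℝ => x + s • (y - x) := by fun_prop
    simpa using (this.tendsto 1).mono_left nhdsWithin_le_nhds
  obtain ⟨s, hs, hs1⟩ := ((hc.eventually (mem_interior_iff_mem_nhds.1 hint)).and
    self_mem_nhdsWithin).exists
  rw [add_sub_cancel_left, map_smul_eq_mul, hy,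
    Real.norm_of_nonneg (zero_le_one.trans (le_of_lt hs1))] at hs
  exact (lt_mul_of_one_lt_left hr hs1).not_ge hs

/-- If a continuous map of a closed ball (for an arbitrary norm `N` on `ℝⁿ`)
moves boundary points by at most `δr`, then its image contains the concentric ball of radius
`(1-δ)r`. -/
theorem degree_surjectivity (n : ℕ) (δ r : ℝ) (hδ0 : 0 < δ) (hδ : δ < 1 / 2) (hr : 0 < r)
    (N : Seminorm ℝ (Fin n → ℝ)) (hN : ∀ v, N v = 0 → v = 0)
    (x : Fin n → ℝ) (f : (Fin n → ℝ) → (Fin n → ℝ))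
    (hf : ContinuousOn f {w | N (w - x) ≤ r})
    (hbd : ∀ y ∈ frontier {w | N (w - x) ≤ r}, N (f y - y) ≤ δ * r) :
    ∀ z, N (z - x) ≤ (1 - δ) * r → z ∈ f '' {w | N (w - x) ≤ r} := by
  intro z hz
  have hNc : Continuous N := N.continuous_of_finiteDimensional
  let p : (Fin n → ℝ) → Fin n → ℝ := fun y => x + (r / max r (N (y - x))) • (y - x)
  let c : (Fin n → ℝ) → ℝ := fun y => max 0 (min 1 (2 - N (y - x) / r))
  have hmax (y) : 0 < max r (N (y - x)) := lt_max_of_lt_left hr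
  have hp : Continuous p := by
    have : Continuous fun y => r / max r (N (y - x)) :=
      continuous_const.div (continuous_const.max (hNc.comp (by fun_prop))) fun y => (hmax y).ne'
    fun_prop
  have hpN (y) : N (p y - x) = r / max r (N (y - x)) * N (y - x) := by
    rw [add_sub_cancel_left, map_smul_eq_mul, Real.norm_of_nonneg (div_pos hr (hmax y)).le]
  have hp_mem (y) : N (p y - x) ≤ r := by
    rw [hpN, div_mul_eq_mul_div, div_le_iff₀ (hmax y)]
    exact mul_le_mul_of_nonneg_left (le_max_right _ _) hr.le
  have hp_in (y) (hy : N (y - x) ≤ r) : p y = y := by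
    simp [p, max_eq_left hy, div_self hr.ne']
  have hp_out (y) (hy : r < N (y - x)) : N (p y - x) = r := by
    rw [hpN, max_eq_right hy.le, div_mul_cancel₀ _ (hr.trans hy).ne']
  have hc_in (y) (hy : N (y - x) ≤ r) : c y = 1 := by
    have : N (y - x) / r ≤ 1 := (div_le_one hr).2 hy
    simp only [c]
    rw [min_eq_left (by linarith), max_eq_right zero_le_one]
  have hc_out (y) (hy : 2 * r < N (y - x)) : c y = 0 := by
    have : 2 < N (y - x) / r := (lt_div_iff₀ hr).2 hy
    exact max_eq_left ((min_le_right _ _).trans (by linarith))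
  let F : (Fin n → ℝ) → Fin n → ℝ := fun y => y + c y • (f (p y) - p y)
  have hF : Continuous F :=
    continuous_id.add ((by fun_prop : Continuous c).smul ((hf.comp_continuous hp hp_mem).sub hp))
  obtain ⟨y, hy⟩ := surjective_of_eqOn_compl_isBounded hF
    (N.isBounded_le_of_eq_zero hN x (2 * r)) (fun y hy => by
      simp [F, hc_out y (not_le.1 hy)]) z
  have hyr : N (y - x) ≤ r := by
    by_contra! hlt
    have hc1 : ‖c y‖ ≤ 1 := by
      rw [Real.norm_of_nonneg (le_max_left _ _)]
      exact max_le zero_le_one (min_le_left _ _)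
    have hdisp : N (c y • (f (p y) - p y)) ≤ δ * r := by
      rw [map_smul_eq_mul]
      exact (mul_le_of_le_one_left (apply_nonneg N _) hc1).trans
        (hbd _ (N.mem_frontier_le_of_eq hr (hp_out y hlt)))
    have hsplit : y - x = (z - x) - c y • (f (p y) - p y) := by
      rw [← hy]
      simp only [F]
      abel
    have := map_sub_le_add N (z - x) (c y • (f (p y) - p y))
    rw [← hsplit] at this
    linarith
  refine ⟨y, hyr, ?_⟩
  simpa [F, hc_in y hyr, hp_in y hyr] using hy
end

section
/- There is an absolute constant C ≥ 1 such that for all 0 < ε < 1 and n ∈ ℕ there exists 0 < δ < 1 with the following property. Let ‖·‖₁, ‖·‖₂ be two norms on ℝⁿ, let x₁, x₂ ∈ ℝⁿ, r > 0, and suppose φ : B_{‖·‖₁}(x₁,r) → B_{‖·‖₂}(x₂,r) is a δr-GHA. Then there exists an affine map T : ℝⁿ → ℝⁿ such that (1 − Cε)‖x − y‖₁ ≤ ‖T(x) − T(y)‖₂ ≤ (1 + Cε)‖x − y‖₁ for all x,y ∈ ℝⁿ, and sup_{x ∈ B_{‖·‖₁}(x₁,r)} ‖φ(x) − T(x)‖₂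 ≤ εr. -/
theorem IsometryEquiv.apply_center_eq {S : Type*} [MetricSpace S] {C : ℝ}
    (hC : ∀ x y : S, dist x y ≤ C) (ρ : S ≃ᵢ S) (z : S) (hz : ρ z = z)
    (hρ : ∀ x, dist (ρ x) x = 2 * dist x z) (g : S ≃ᵢ S) : g z = z := by
  have key : ∀ (m : ℕ) (g : S ≃ᵢ S), 2 ^ m * dist (g z) z ≤ C := by
    intro m
    induction m with
    | zero => intro g; simpa using hC _ _
    | succ m ih =>
      intro g
      have h := ih (((g.trans ρ).trans g.symm).trans ρ)
      have h2 : dist ((((g.trans ρ).trans g.symm).trans ρ) z) z = 2 * dist (g z) z := by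
        calc _ = dist (ρ (g.symm (ρ (g z)))) (ρ z) := by rw [hz]; rfl
          _ = dist (g.symm (ρ (g z))) (g.symm (g z)) := by
            rw [ρ.dist_eq, g.symm_apply_apply]
          _ = _ := by rw [g.symm.dist_eq, hρ]
      rw [h2] at h
      rw [pow_succ, mul_assoc]
      exact h
  by_contra hne
  have hpos : 0 < dist (g z) z := dist_pos.2 hne
  obtain ⟨m, hm⟩ := pow_unbounded_of_one_lt (C / dist (g z) z) (one_lt_two)
  rw [div_lt_iff₀ hpos] at hm
  exact absurd (key m g) (not_le.2 hm)

theorem sub_mem_lens {E : Type*} [NormedAddCommGroup E] (y v : E) (h : ‖v‖ ≤ ‖y‖ / 2 ∧ ‖v - y‖ ≤ ‖y‖ / 2) :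
    ‖y - v‖ ≤ ‖y‖ / 2 ∧ ‖y - v - y‖ ≤ ‖y‖ / 2 := by
  rw [norm_sub_rev, show y - v - y = -v by abel, norm_neg]
  exact ⟨h.2, h.1⟩

section

variable {E F : Type*} [NormedAddCommGroup E] [NormedSpace ℝ E]
  [NormedAddCommGroup F] [NormedSpace ℝ F]

/-- The point reflection of a set that is symmetric about `(1 / 2) • x`. -/
def reflectOn (S : Set E) (x : E) (hS : ∀ v ∈ S, x - v ∈ S) : S ≃ᵢ S where
  toFun v := ⟨x - v, hS v v.2⟩
  invFun v := ⟨x - v, hS v v.2⟩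
  left_inv v := by simp
  right_inv v := by simp
  isometry_toFun := Isometry.of_dist_eq fun v w => by
    rw [Subtype.dist_eq, Subtype.dist_eq, dist_sub_left]

theorem norm_inv_pow_smul_le_one {m : ℕ} {x : E} (h : ‖x‖ ≤ 2 ^ m) :
    ‖(2 ^ m : ℝ)⁻¹ • x‖ ≤ 1 := by
  rwa [norm_smul, norm_inv, norm_pow, Real.norm_ofNat, inv_mul_le_iff₀ (by positivity), mul_one]

theorem half_smul_mem_lens (y : E) :
    ‖(1 / 2 : ℝ) • y‖ ≤ ‖y‖ / 2 ∧ ‖(1 / 2 : ℝ) • y - y‖ ≤ ‖y‖ / 2 := by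
  have h : (1 / 2 : ℝ) • y - y = (-(1 / 2) : ℝ) • y := by module
  have h2 : ‖(1 / 2 : ℝ) • y‖ = ‖y‖ / 2 := by
    rw [norm_smul, Real.norm_of_nonneg (by norm_num)]; ring
  rw [h, neg_smul, norm_neg, h2]
  exact ⟨le_rfl, le_rfl⟩

theorem map_half_of_symmetric {S : Set E} {S' : Set F} {x : E} {x' : F} {C : ℝ}
    (hC : ∀ v ∈ S, ∀ w ∈ S, dist v w ≤ C)
    (hS : ∀ v ∈ S, x - v ∈ S) (hS' : ∀ v ∈ S', x' - v ∈ S')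
    (hx : (1 / 2 : ℝ) • x ∈ S)
    {f : E → F} (hf : Set.MapsTo f S S') (hiso : ∀ v ∈ S, ∀ w ∈ S, dist (f v) (f w) = dist v w)
    (hsurj : Set.SurjOn f S S') : f ((1 / 2 : ℝ) • x) = (1 / 2 : ℝ) • x' := by
  have hI : Isometry (hf.restrict f S S') :=
    Isometry.of_dist_eq fun v w => hiso v v.2 w w.2
  let e : S ≃ᵢ S' := ⟨Equiv.ofBijective (hf.restrict f S S')
    ⟨hI.injective, hf.restrict_surjective_iff.2 hsurj⟩, hI⟩
  let z : S := ⟨(1 / 2 : ℝ) • x, hx⟩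
  have hfix := IsometryEquiv.apply_center_eq (S := S) (C := C) (fun v w => hC v v.2 w w.2)
    (reflectOn S x hS) z (Subtype.ext (by simp only [reflectOn, z]; change x - (1 / 2 : ℝ) • x = _; module))
    (fun v => by
      change dist (x - v) (v : E) = 2 * dist (v : E) ((1 / 2 : ℝ) • x)
      have h : x - v - v = (-2 : ℝ) • ((v : E) - (1 / 2 : ℝ) • x) := by module
      rw [dist_eq_norm, dist_eq_norm, h, norm_smul]
      norm_num)
    (((e.trans (reflectOn S' x' hS')).trans e.symm).trans (reflectOn S x hS))
  have h1 : (e.symm (reflectOn S' x' hS' (e z))) = z := by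
    have h : reflectOn S x hS (e.symm (reflectOn S' x' hS' (e z))) = z := hfix
    have h2 := congrArg Subtype.val h
    change x - (e.symm (reflectOn S' x' hS' (e z)) : E) = (1 / 2 : ℝ) • x at h2
    apply Subtype.ext
    change _ = (1 / 2 : ℝ) • x
    rw [sub_eq_iff_eq_add] at h2
    rw [← sub_eq_iff_eq_add'] at h2
    rw [← h2]; module
  have h3 : reflectOn S' x' hS' (e z) = e z := by
    have h := congrArg e h1
    rwa [e.apply_symm_apply] at h
  have h4 : x' - f ((1 / 2 : ℝ) • x) = f ((1 / 2 : ℝ) • x) := congrArg Subtype.val h3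
  rw [sub_eq_iff_eq_add] at h4
  rw [h4]; module

theorem unitBall_isometry_map_zero {f : E → F} (hf : ∀ v, ‖v‖ ≤ 1 → ‖f v‖ ≤ 1)
    (hiso : ∀ v w, ‖v‖ ≤ 1 → ‖w‖ ≤ 1 → ‖f v - f w‖ = ‖v - w‖)
    (hsurj : ∀ u, ‖u‖ ≤ 1 → ∃ v, ‖v‖ ≤ 1 ∧ f v = u) : f 0 = 0 := by
  have := map_half_of_symmetric (S := {v : E | ‖v‖ ≤ 1}) (S' := {v : F | ‖v‖ ≤ 1})
    (x := 0) (x' := 0) (C := 2) (f := f) ?_ ?_ ?_ ?_ hf ?_ ?_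
  · simpa using this
  · intro v hv w hw
    rw [dist_eq_norm]
    have := norm_sub_le v w
    simp only [Set.mem_ofPred_eq] at hv hw
    linarith
  · simp
  · simp
  · simp
  · intro v hv w hw
    rw [dist_eq_norm, dist_eq_norm, hiso v w hv hw]
  · intro u hu
    obtain ⟨v, hv, h⟩ := hsurj u hu
    exact ⟨v, hv, h⟩

theorem unitBall_isometry_norm {f : E → F} (hf : ∀ v, ‖v‖ ≤ 1 → ‖f v‖ ≤ 1)
    (hiso : ∀ v w, ‖v‖ ≤ 1 → ‖w‖ ≤ 1 → ‖f v - f w‖ = ‖v - w‖)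
    (hsurj : ∀ u, ‖u‖ ≤ 1 → ∃ v, ‖v‖ ≤ 1 ∧ f v = u)
    {v : E} (hv : ‖v‖ ≤ 1) : ‖f v‖ = ‖v‖ := by
  have := hiso v 0 hv (by simp)
  rwa [unitBall_isometry_map_zero hf hiso hsurj, sub_zero, sub_zero] at this

theorem unitBall_isometry_map_half {f : E → F} (hf : ∀ v, ‖v‖ ≤ 1 → ‖f v‖ ≤ 1)
    (hiso : ∀ v w, ‖v‖ ≤ 1 → ‖w‖ ≤ 1 → ‖f v - f w‖ = ‖v - w‖)
    (hsurj : ∀ u, ‖u‖ ≤ 1 → ∃ v, ‖v‖ ≤ 1 ∧ f v = u)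
    {x : E} (hx : ‖x‖ ≤ 1) :
    f ((1 / 2 : ℝ) • x) = (1 / 2 : ℝ) • f x := by
  have hn : ∀ {v : E}, ‖v‖ ≤ 1 → ‖f v‖ = ‖v‖ := unitBall_isometry_norm hf hiso hsurj
  have hle : ∀ {v : E}, ‖v‖ ≤ ‖x‖ / 2 → ‖v‖ ≤ 1 := fun h => by
    linarith [norm_nonneg x]
  refine map_half_of_symmetric (S := {v : E | ‖v‖ ≤ ‖x‖ / 2 ∧ ‖v - x‖ ≤ ‖x‖ / 2})
    (S' := {v : F | ‖v‖ ≤ ‖f x‖ / 2 ∧ ‖v - f x‖ ≤ ‖f x‖ / 2})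
    (C := 2) (f := f) ?_ (sub_mem_lens x)
    (sub_mem_lens (f x)) (half_smul_mem_lens x) ?_ ?_ ?_
  · intro v hv w hw
    rw [dist_eq_norm]
    have := norm_sub_le v w
    linarith [hle hv.1, hle hw.1]
  · intro v hv
    have h1 := hle hv.1
    exact ⟨by rw [hn h1, hn hx]; exact hv.1, by rw [hiso v x h1 hx, hn hx]; exact hv.2⟩
  · intro v hv w hw
    rw [dist_eq_norm, dist_eq_norm, hiso v w (hle hv.1) (hle hw.1)]
  · rintro u ⟨hu1, hu2⟩
    rw [hn hx] at hu1 hu2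
    obtain ⟨v, hv, rfl⟩ := hsurj u (by linarith [norm_nonneg x])
    rw [hn hv] at hu1
    rw [hiso v x hv hx] at hu2
    exact ⟨v, ⟨hu1, hu2⟩, rfl⟩

/-- Mankiewicz's theorem for unit balls. -/
theorem exists_linearIsometryEquiv_eq_on_unitBall {f : E → F} (hf : ∀ v, ‖v‖ ≤ 1 → ‖f v‖ ≤ 1)
    (hiso : ∀ v w, ‖v‖ ≤ 1 → ‖w‖ ≤ 1 → ‖f v - f w‖ = ‖v - w‖)
    (hsurj : ∀ u, ‖u‖ ≤ 1 → ∃ v, ‖v‖ ≤ 1 ∧ f v = u) :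
    ∃ L : E ≃ₗᵢ[ℝ] F, ∀ v, ‖v‖ ≤ 1 → f v = L v := by
  let D : ℕ → E → F := fun m x => (2 ^ m : ℝ) • f ((2 ^ m : ℝ)⁻¹ • x)
  have hball : ∀ {m : ℕ} {x : E}, ‖x‖ ≤ 2 ^ m → ‖(2 ^ m : ℝ)⁻¹ • x‖ ≤ 1 :=
    fun h => norm_inv_pow_smul_le_one h
  have hstep : ∀ (m : ℕ) (x : E), ‖x‖ ≤ 2 ^ m → D (m + 1) x = D m x := by
    intro m x h
    have h1 := unitBall_isometry_map_half hf hiso hsurj (hball h)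
    have h2 : (2 ^ (m + 1) : ℝ)⁻¹ • x = (1 / 2 : ℝ) • (2 ^ m : ℝ)⁻¹ • x := by
      rw [smul_smul, pow_succ, mul_inv]; congr 1; ring
    simp only [D]
    rw [h2, h1, smul_smul]; congr 1; ring
  have hmono : ∀ (j m : ℕ) (x : E), ‖x‖ ≤ 2 ^ m → D (m + j) x = D m x := by
    intro j m x h
    induction j with
    | zero => rfl
    | succ j ih =>
      rw [← add_assoc, hstep _ _ (h.trans (pow_le_pow_right₀ one_le_two (by lia))), ih]
  have hceil : ∀ t : ℝ, t ≤ 2 ^ ⌈t⌉₊ := fun t => (Nat.le_ceil t).trans (by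
    exact_mod_cast (Nat.lt_two_pow_self).le)
  let G : E → F := fun x => D ⌈‖x‖⌉₊ x
  have hG : ∀ (m : ℕ) (x : E), ‖x‖ ≤ 2 ^ m → G x = D m x := by
    intro m x h
    rw [← hmono ⌈‖x‖⌉₊ m x h, add_comm, hmono _ _ _ (hceil _)]
  have hGiso : Isometry G := by
    refine Isometry.of_dist_eq fun x y => ?_
    set m := ⌈max ‖x‖ ‖y‖⌉₊ with hm
    have hx : ‖x‖ ≤ 2 ^ m := (le_max_left _ _).trans (hceil _)
    have hy : ‖y‖ ≤ 2 ^ m := (le_max_right _ _).trans (hceil _)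
    rw [hG m x hx, hG m y hy, dist_eq_norm, dist_eq_norm]
    simp only [D]
    rw [← smul_sub, norm_smul, hiso _ _ (hball hx) (hball hy), ← smul_sub, ← norm_smul,
      smul_inv_smul₀ (by positivity)]
  have hGsurj : Function.Surjective G := by
    intro y
    obtain ⟨v, hv, h⟩ := hsurj _ (norm_inv_pow_smul_le_one (hceil ‖y‖))
    refine ⟨(2 ^ ⌈‖y‖⌉₊ : ℝ) • v, ?_⟩
    rw [hG ⌈‖y‖⌉₊]
    · simp only [D]
      rw [inv_smul_smul₀ (by positivity), h, smul_inv_smul₀ (by positivity)]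
    · rw [norm_smul, norm_pow, Real.norm_ofNat]
      exact mul_le_of_le_one_right (by positivity) hv
  let e : E ≃ᵢ F := ⟨Equiv.ofBijective G ⟨hGiso.injective, hGsurj⟩, hGiso⟩
  have hGf : ∀ v, ‖v‖ ≤ 1 → G v = f v := fun v hv => by
    rw [hG 0 v (by simpa using hv)]; simp [D]
  have h0 : e 0 = 0 := (hGf 0 (by simp)).trans (unitBall_isometry_map_zero hf hiso hsurj)
  exact ⟨e.toRealLinearIsometryEquivOfMapZero h0, fun v hv => (hGf v hv).symm⟩

end
open Filter Topology

theorem exists_auerbach_basis (V : Type*) [NormedAddCommGroup V] [NormedSpace ℝ V]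
    [FiniteDimensional ℝ V] {n : ℕ} (hn : Module.finrank ℝ V = n) :
    ∃ b : Module.Basis (Fin n) ℝ V, (∀ i, ‖b i‖ ≤ 1) ∧ ∀ i v, |b.coord i v| ≤ ‖v‖ := by
  have : ProperSpace V := FiniteDimensional.proper ℝ V
  let b₀ : Module.Basis (Fin n) ℝ V := Module.finBasisOfFinrankEq ℝ V hn
  have hK : IsCompact (Set.pi Set.univ fun _ : Fin n => Metric.closedBall (0 : V) 1) :=
    isCompact_univ_pi fun _ => isCompact_closedBall _ _
  have hcont : Continuous fun v : Fin n → V => |b₀.det v| := by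
    simp only [Module.Basis.det_apply]
    refine (Continuous.matrix_det (continuous_matrix fun i j => ?_)).abs
    exact (LinearMap.continuous_of_finiteDimensional (b₀.coord i)).comp (continuous_apply j)
  obtain ⟨v, hv, hmax⟩ := hK.exists_isMaxOn ⟨0, by simp⟩ hcont.continuousOn
  have hv1 : ∀ i, ‖v i‖ ≤ 1 := by simpa [Set.mem_pi] using hv
  have hdet : b₀.det v ≠ 0 := by
    intro h0
    have hmem : (fun i => ‖b₀ i‖⁻¹ • b₀ i) ∈
        Set.pi Set.univ fun _ : Fin n => Metric.closedBall (0 : V) 1 := by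
      intro i _
      rw [mem_closedBall_zero_iff, norm_smul, norm_inv, norm_norm,
        inv_mul_cancel₀ (norm_ne_zero_iff.2 (b₀.ne_zero i))]
    have h1 := hmax hmem
    simp only [Set.mem_ofPred_eq, h0, abs_zero] at h1
    rw [AlternatingMap.map_smul_univ, b₀.det_self, smul_eq_mul, mul_one, abs_nonpos_iff,
      Finset.prod_eq_zero_iff] at h1
    obtain ⟨i, _, hi⟩ := h1
    exact b₀.ne_zero i (norm_eq_zero.1 (inv_eq_zero.1 hi))
  obtain ⟨hli, hsp⟩ := (Module.Basis.is_basis_iff_det b₀).2 hdet.isUnit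
  refine ⟨Module.Basis.mk hli hsp.ge, fun i => by simpa using hv1 i, fun i => ?_⟩
  have hball : ∀ w : V, ‖w‖ ≤ 1 → |(Module.Basis.mk hli hsp.ge).coord i w| ≤ 1 := by
    intro w hw
    have h := congrArg (fun l : V →ₗ[ℝ] ℝ => l w)
      (b₀.det_smul_mk_coord_eq_det_update hli hsp.ge i)
    have h2 : b₀.det v * (Module.Basis.mk hli hsp.ge).coord i w
        = b₀.det (Function.update v i w) := h
    have hmem : Function.update v i w ∈
        Set.pi Set.univ fun _ : Fin n => Metric.closedBall (0 : V) 1 := by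
      intro j _
      rw [mem_closedBall_zero_iff]
      rcases eq_or_ne j i with rfl | hj
      · simpa using hw
      · simpa [hj] using hv1 j
    have h3 : |b₀.det (Function.update v i w)| ≤ |b₀.det v| := hmax hmem
    rw [← h2, abs_mul] at h3
    exact le_of_mul_le_mul_left (by simpa using h3) (abs_pos.2 hdet)
  intro w
  rcases eq_or_ne w 0 with rfl | hw
  · rw [map_zero, abs_zero, norm_zero]
  have hw' := norm_pos_iff.2 hw
  have h := hball (‖w‖⁻¹ • w) (by
    rw [norm_smul, norm_inv, norm_norm, inv_mul_cancel₀ hw'.ne'])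
  rwa [map_smul, smul_eq_mul, abs_mul, abs_inv, abs_norm, inv_mul_le_iff₀ hw', mul_one] at h

section

variable {V W : Type*} [AddCommGroup V] [Module ℝ V] [AddCommGroup W] [Module ℝ W]

theorem Seminorm.normedSpaceCore (N : Seminorm ℝ V) (hN : ∀ v, N v = 0 → v = 0) :
    letI : Norm V := ⟨N⟩
    NormedSpace.Core ℝ V :=
  let : Norm V := ⟨N⟩
  { norm_nonneg := apply_nonneg N
    norm_smul := map_smul_eq_mul N
    norm_triangle := map_add_le_add N
    norm_eq_zero_iff := fun x => ⟨hN x, fun h => by subst h; exact map_zero N⟩ }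

theorem Seminorm.exists_linearEquiv_norm_le [FiniteDimensional ℝ V] {n : ℕ}
    (hn : Module.finrank ℝ V = n) (N : Seminorm ℝ V) (hN : ∀ v, N v = 0 → v = 0) :
    ∃ A : (Fin n → ℝ) ≃ₗ[ℝ] V, ∀ c, ‖c‖ ≤ N (A c) ∧ N (A c) ≤ n * ‖c‖ := by
  let : Norm V := ⟨N⟩
  let : NormedAddCommGroup V := NormedAddCommGroup.ofCore (N.normedSpaceCore hN)
  let : NormedSpace ℝ V := NormedSpace.ofCore (N.normedSpaceCore hN)
  obtain ⟨b, hb, hcoord⟩ := exists_auerbach_basis V hn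
  refine ⟨b.equivFun.symm, fun c => ⟨?_, ?_⟩⟩
  · change ‖c‖ ≤ ‖b.equivFun.symm c‖
    refine (pi_norm_le_iff_of_nonneg (norm_nonneg _)).2 fun i => ?_
    simpa only [Real.norm_eq_abs, Module.Basis.coord_apply, ← Module.Basis.equivFun_apply,
      LinearEquiv.apply_symm_apply] using hcoord i (b.equivFun.symm c)
  · change ‖b.equivFun.symm c‖ ≤ n * ‖c‖
    rw [b.equivFun_symm_apply]
    calc _ ≤ ∑ i, ‖c i • b i‖ := norm_sum_le _ _
      _ ≤ ∑ _i : Fin n, ‖c‖ := Finset.sum_le_sum fun i _ => by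
          rw [norm_smul]
          exact (mul_le_of_le_one_right (norm_nonneg _) (hb i)).trans (norm_le_pi_norm c i)
      _ = _ := by simp

theorem Seminorm.exists_linearMap_eq_on_unitBall (M₁ : Seminorm ℝ V) (M₂ : Seminorm ℝ W)
    (h₁ : ∀ v, M₁ v = 0 → v = 0) (h₂ : ∀ v, M₂ v = 0 → v = 0) {f : V → W}
    (hf : ∀ v, M₁ v ≤ 1 → M₂ (f v) ≤ 1)
    (hiso : ∀ v w, M₁ v ≤ 1 → M₁ w ≤ 1 → M₂ (f v - f w) = M₁ (v - w))
    (hsurj : ∀ u, M₂ u ≤ 1 → ∃ v, M₁ v ≤ 1 ∧ f v = u) :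
    ∃ L : V →ₗ[ℝ] W, (∀ v, M₂ (L v) = M₁ v) ∧ ∀ v, M₁ v ≤ 1 → f v = L v := by
  let : Norm V := ⟨M₁⟩
  let : NormedAddCommGroup V := NormedAddCommGroup.ofCore (M₁.normedSpaceCore h₁)
  let : NormedSpace ℝ V := NormedSpace.ofCore (M₁.normedSpaceCore h₁)
  let : Norm W := ⟨M₂⟩
  let : NormedAddCommGroup W := NormedAddCommGroup.ofCore (M₂.normedSpaceCore h₂)
  let : NormedSpace ℝ W := NormedSpace.ofCore (M₂.normedSpaceCore h₂)
  obtain ⟨L, hL⟩ := exists_linearIsometryEquiv_eq_on_unitBall (E := V) (F := W) hf hiso hsurj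
  exact ⟨L.toLinearEquiv.toLinearMap, fun v => L.norm_map v, hL⟩

end

theorem Ultrafilter.exists_tendsto_of_norm_le {E : Type*} [NormedAddCommGroup E]
    [ProperSpace E] (U : Ultrafilter ℕ) {a : ℕ → E}
    {B : ℝ} (h : ∀ k, ‖a k‖ ≤ B) : ∃ x, Tendsto a U (𝓝 x) := by
  obtain ⟨x, -, hx⟩ := (isCompact_closedBall (0 : E) B).ultrafilter_le_nhds (U.map a) (by
    rw [le_principal_iff]
    exact Filter.mem_map.2 (Filter.univ_mem' fun k => by simpa using h k))
  exact ⟨x, hx⟩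

section

variable {E F : Type*} [NormedAddCommGroup E] [NormedSpace ℝ E]
  [NormedAddCommGroup F] [NormedSpace ℝ F]

theorem Seminorm.exists_ultrafilter_limit (U : Ultrafilter ℕ) (M : ℕ → Seminorm ℝ E) {c : ℝ}
    (hM : ∀ k v, M k v ≤ c * ‖v‖) :
    ∃ N : Seminorm ℝ E, ∀ (v : ℕ → E) (x : E), Tendsto v U (𝓝 x) →
      Tendsto (fun k => M k (v k)) U (𝓝 (N x)) := by
  have hex : ∀ x, ∃ t, Tendsto (fun k => M k x) U (𝓝 t) := fun x =>
    U.exists_tendsto_of_norm_le (B := c * ‖x‖) fun k => by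
      rw [Real.norm_of_nonneg (apply_nonneg _ _)]; exact hM k x
  choose N hN using hex
  refine ⟨Seminorm.of N (fun x y => ?_) (fun a x => ?_), fun v x hv => ?_⟩
  · exact le_of_tendsto_of_tendsto' (hN _) ((hN x).add (hN y)) fun k => map_add_le_add (M k) x y
  · refine tendsto_nhds_unique (hN (a • x)) ?_
    simpa only [map_smul_eq_mul] using (hN x).const_mul ‖a‖
  · have h0 : Tendsto (fun k => M k (v k) - M k x) U (𝓝 0) := by
      refine squeeze_zero_norm (fun k => (abs_sub_map_le_sub (M k) (v k) x).trans (hM k _)) ?_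
      simpa using ((hv.sub_const x).norm).const_mul c
    have h1 := h0.add (hN x)
    simp only [sub_add_cancel, zero_add] at h1
    exact h1

/-- The radial retraction onto the unit ball of a seminorm. -/
noncomputable def Seminorm.retract (M : Seminorm ℝ E) (v : E) : E := (max 1 (M v))⁻¹ • v

theorem Seminorm.retract_le_one (M : Seminorm ℝ E) (v : E) : M (M.retract v) ≤ 1 := by
  have h : 0 < max 1 (M v) := lt_max_of_lt_left one_pos
  rw [Seminorm.retract, map_smul_eq_mul, norm_inv, Real.norm_of_nonneg h.le,
    inv_mul_le_iff₀ h, mul_one]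
  exact le_max_right _ _

theorem Seminorm.tendsto_retract {U : Ultrafilter ℕ} {M : ℕ → Seminorm ℝ E} {N : Seminorm ℝ E}
    (hM : ∀ (v : ℕ → E) (x : E), Tendsto v U (𝓝 x) → Tendsto (fun k => M k (v k)) U (𝓝 (N x)))
    {v : E} (hv : N v ≤ 1) : Tendsto (fun k => (M k).retract v) U (𝓝 v) := by
  have h1 : Tendsto (fun k => max 1 (M k v)) U (𝓝 (max 1 (N v))) :=
    tendsto_const_nhds.max (hM _ v tendsto_const_nhds)
  rw [max_eq_left hv] at h1
  have h2 := (h1.inv₀ one_ne_zero).smul_const v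
  rw [inv_one, one_smul] at h2
  exact h2

variable [FiniteDimensional ℝ E] [FiniteDimensional ℝ F]

theorem exists_ultrafilter_limit_linear_isometry (U : Ultrafilter ℕ)
    {M₁ : ℕ → Seminorm ℝ E} {M₂ : ℕ → Seminorm ℝ F} {N₁ : Seminorm ℝ E} {N₂ : Seminorm ℝ F}
    (hM₁ : ∀ (v : ℕ → E) (x : E), Tendsto v U (𝓝 x) → Tendsto (fun k => M₁ k (v k)) U (𝓝 (N₁ x)))
    (hM₂ : ∀ (v : ℕ → F) (x : F), Tendsto v U (𝓝 x) → Tendsto (fun k => M₂ k (v k)) U (𝓝 (N₂ x)))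
    (hle₁ : ∀ k v, ‖v‖ ≤ M₁ k v) (hle₂ : ∀ k v, ‖v‖ ≤ M₂ k v)
    {δ : ℕ → ℝ} (hδ : Tendsto δ U (𝓝 0)) {ψ : ℕ → E → F}
    (hmaps : ∀ k v, M₁ k v ≤ 1 → M₂ k (ψ k v) ≤ 1)
    (hdist : ∀ k v w, M₁ k v ≤ 1 → M₁ k w ≤ 1 →
      |M₁ k (v - w) - M₂ k (ψ k v - ψ k w)| ≤ δ k)
    (honto : ∀ k u, M₂ k u ≤ 1 → ∃ v, M₁ k v ≤ 1 ∧ M₂ k (u - ψ k v) ≤ δ k) :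
    ∃ L : E →ₗ[ℝ] F, (∀ v, N₂ (L v) = N₁ v) ∧
      ∀ (v : ℕ → E) (x : E), (∀ k, M₁ k (v k) ≤ 1) → Tendsto v U (𝓝 x) →
        Tendsto (fun k => ψ k (v k)) U (𝓝 (L x)) := by
  have : ProperSpace E := FiniteDimensional.proper ℝ E
  have : ProperSpace F := FiniteDimensional.proper ℝ F
  have hN₁ : ∀ v, ‖v‖ ≤ N₁ v := fun v =>
    ge_of_tendsto' (hM₁ _ v tendsto_const_nhds) fun k => hle₁ k v
  have hN₂ : ∀ v, ‖v‖ ≤ N₂ v := fun v =>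
    ge_of_tendsto' (hM₂ _ v tendsto_const_nhds) fun k => hle₂ k v
  have hex : ∀ x, ∃ y, Tendsto (fun k => ψ k ((M₁ k).retract x)) U (𝓝 y) := fun x =>
    U.exists_tendsto_of_norm_le (B := 1) fun k =>
      (hle₂ k _).trans (hmaps k _ ((M₁ k).retract_le_one x))
  choose f hf using hex
  have hball : ∀ (v : ℕ → E) (x : E), (∀ k, M₁ k (v k) ≤ 1) → Tendsto v U (𝓝 x) → N₁ x ≤ 1 :=
    fun v x hv hx => le_of_tendsto' (hM₁ v x hx) hv
  have hlim : ∀ (v : ℕ → E) (x : E), (∀ k, M₁ k (v k) ≤ 1) → Tendsto v U (𝓝 x) →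
      Tendsto (fun k => ψ k (v k)) U (𝓝 (f x)) := by
    intro v x hv hx
    have hsub := hx.sub (Seminorm.tendsto_retract hM₁ (hball v x hv hx))
    have h0 := (hM₁ _ _ hsub).add hδ
    rw [sub_self, map_zero, add_zero] at h0
    have h1 : Tendsto (fun k => ψ k (v k) - ψ k ((M₁ k).retract x)) U (𝓝 0) := by
      refine squeeze_zero_norm (fun k => (hle₂ k _).trans ?_) h0
      have := abs_le.1 (hdist k _ _ (hv k) ((M₁ k).retract_le_one x))
      linarith [this.1]
    simpa using h1.add (hf x)
  obtain ⟨L, hL, hfL⟩ := N₁.exists_linearMap_eq_on_unitBall N₂ (f := f)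
    (fun v h => norm_le_zero_iff.1 ((hN₁ v).trans h.le))
    (fun v h => norm_le_zero_iff.1 ((hN₂ v).trans h.le))
    (fun v _ => le_of_tendsto' (hM₂ _ _ (hf v))
      fun k => hmaps k _ ((M₁ k).retract_le_one v))
    (fun v w hv hw => by
      have h1 := hM₁ _ _ ((Seminorm.tendsto_retract hM₁ hv).sub (Seminorm.tendsto_retract hM₁ hw))
      have h2 := hM₂ _ _ ((hf v).sub (hf w))
      have h3 := squeeze_zero_norm (fun k => (Real.norm_eq_abs _).trans_le <| hdist k _ _ ((M₁ k).retract_le_one v)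
        ((M₁ k).retract_le_one w)) hδ
      exact (sub_eq_zero.1 (tendsto_nhds_unique (h1.sub h2) h3)).symm)
    (fun u hu => by
      choose v hv hvu using fun k => honto k _ ((M₂ k).retract_le_one u)
      obtain ⟨x, hx⟩ := U.exists_tendsto_of_norm_le (B := 1) fun k => (hle₁ k _).trans (hv k)
      refine ⟨x, hball v x hv hx, ?_⟩
      have h1 := (Seminorm.tendsto_retract hM₂ hu).sub (hlim v x hv hx)
      have h2 := squeeze_zero_norm (fun k => (hle₂ k _).trans (hvu k)) hδ
      exact (sub_eq_zero.1 (tendsto_nhds_unique h1 h2)).symm)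
  refine ⟨L, hL, fun v x hv hx => ?_⟩
  rw [← hfL x (hball v x hv hx)]
  exact hlim v x hv hx

end

theorem GHA_near_linear_of_norm_le (n : ℕ) {ε : ℝ} (hε : 0 < ε) :
    ∃ δ : ℝ, 0 < δ ∧ δ < 1 ∧ ∀ M₁ M₂ : Seminorm ℝ (Fin n → ℝ),
      (∀ v, ‖v‖ ≤ M₁ v ∧ M₁ v ≤ n * ‖v‖) → (∀ v, ‖v‖ ≤ M₂ v ∧ M₂ v ≤ n * ‖v‖) →
      ∀ ψ : (Fin n → ℝ) → (Fin n → ℝ), (∀ v, M₁ v ≤ 1 → M₂ (ψ v) ≤ 1) →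
        (∀ v w, M₁ v ≤ 1 → M₁ w ≤ 1 → |M₁ (v - w) - M₂ (ψ v - ψ w)| ≤ δ) →
        (∀ u, M₂ u ≤ 1 → ∃ v, M₁ v ≤ 1 ∧ M₂ (u - ψ v) ≤ δ) →
        ∃ T : (Fin n → ℝ) →ₗ[ℝ] (Fin n → ℝ),
          ∀ v, |M₂ (T v) - M₁ v| ≤ ε * M₁ v ∧ (M₁ v ≤ 1 → M₂ (ψ v - T v) ≤ ε) := by
  by_contra! hcon
  have hδ0 : ∀ k : ℕ, (0 : ℝ) < 1 / ((k + 1 : ℕ) + 1) := fun k => by positivity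
  have hδ1 : ∀ k : ℕ, (1 : ℝ) / ((k + 1 : ℕ) + 1) < 1 := fun k => by
    rw [div_lt_one (by positivity)]; push_cast; linarith [(Nat.cast_nonneg k : (0 : ℝ) ≤ k)]
  choose M₁ M₂ hM₁ hM₂ ψ hmaps hdist honto hT using fun k => hcon _ (hδ0 k) (hδ1 k)
  let U : Ultrafilter ℕ := hyperfilter ℕ
  have hδ : Tendsto (fun k : ℕ => (1 : ℝ) / ((k + 1 : ℕ) + 1)) U (𝓝 0) :=
    ((tendsto_add_atTop_iff_nat 1).2 tendsto_one_div_add_atTop_nhds_zero_nat).mono_left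
      Nat.hyperfilter_le_atTop
  obtain ⟨N₁, hN₁⟩ := Seminorm.exists_ultrafilter_limit U M₁ fun k v => (hM₁ k v).2
  obtain ⟨N₂, hN₂⟩ := Seminorm.exists_ultrafilter_limit U M₂ fun k v => (hM₂ k v).2
  obtain ⟨L, hL, hlim⟩ := exists_ultrafilter_limit_linear_isometry U hN₁ hN₂
    (fun k v => (hM₁ k v).1) (fun k v => (hM₂ k v).1) hδ hmaps hdist honto
  have hbad : ∀ k, ∃ v, M₁ k v ≤ 1 ∧
      (ε ≤ |M₂ k (L v) - M₁ k v| ∨ ε ≤ M₂ k (ψ k v - L v)) := by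
    intro k
    obtain ⟨v, hv⟩ := hT k L
    by_cases h : |M₂ k (L v) - M₁ k v| ≤ ε * M₁ k v
    · exact ⟨v, (hv h).1, Or.inr (hv h).2.le⟩
    · push Not at h
      rcases (apply_nonneg (M₁ k) v).eq_or_lt with h0 | hpos
      · have hv0 : v = 0 := norm_le_zero_iff.1 ((hM₁ k v).1.trans h0.ge)
        simp [hv0] at h
      · have hs : ‖(M₁ k v)⁻¹‖ = (M₁ k v)⁻¹ := Real.norm_of_nonneg (inv_nonneg.2 hpos.le)
        refine ⟨(M₁ k v)⁻¹ • v, ?_, Or.inl ?_⟩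
        · rw [map_smul_eq_mul, hs, inv_mul_cancel₀ hpos.ne']
        · rw [map_smul, map_smul_eq_mul, map_smul_eq_mul, hs, ← mul_sub, abs_mul,
            abs_of_pos (inv_pos.2 hpos), le_inv_mul_iff₀ hpos, mul_comm]
          exact h.le
  choose v hv hbad using hbad
  obtain ⟨x, hx⟩ := U.exists_tendsto_of_norm_le (B := 1) fun k => (hM₁ k _).1.trans (hv k)
  have hLx := ((LinearMap.continuous_of_finiteDimensional L).tendsto x).comp hx
  have h1 := ((hN₂ _ _ hLx).sub (hN₁ _ _ hx)).abs
  have h2 := hN₂ _ _ ((hlim v x hv hx).sub hLx)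
  rw [hL, sub_self, abs_zero] at h1
  rw [sub_self, map_zero] at h2
  obtain ⟨k, hk1, hk2⟩ := ((h1.eventually_lt_const hε).and (h2.eventually_lt_const hε)).exists
  rcases hbad k with h | h
  · exact absurd hk1 (not_lt.2 h)
  · exact absurd hk2 (not_lt.2 h)

/-- A `δr`-GHA between balls of two norms on `ℝⁿ` is `εr`-close to an
affine map which is `(1 ± Cε)`-bi-Lipschitz between the two norms. -/
theorem GHA_near_affine :
    ∃ C : ℝ, 1 ≤ C ∧
      ∀ (n : ℕ) (ε : ℝ), 0 < ε → ε < 1 →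
        ∃ δ : ℝ, 0 < δ ∧ δ < 1 ∧
          ∀ N₁ N₂ : Seminorm ℝ (Fin n → ℝ),
            (∀ v, N₁ v = 0 → v = 0) → (∀ v, N₂ v = 0 → v = 0) →
          ∀ (x₁ x₂ : Fin n → ℝ) (r : ℝ), 0 < r →
          ∀ φ : (Fin n → ℝ) → (Fin n → ℝ),
            (∀ v, N₁ (v - x₁) ≤ r → N₂ (φ v - x₂) ≤ r) →
            (∀ v w, N₁ (v - x₁) ≤ r → N₁ (w - x₁) ≤ r →
              |N₁ (v - w) - N₂ (φ v - φ w)| ≤ δ * r) →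
            (∀ u, N₂ (u - x₂) ≤ r → ∃ v, N₁ (v - x₁) ≤ r ∧ N₂ (u - φ v) ≤ δ * r) →
            ∃ T : (Fin n → ℝ) →ᵃ[ℝ] (Fin n → ℝ),
              (∀ v w : Fin n → ℝ, (1 - C * ε) * N₁ (v - w) ≤ N₂ (T v - T w) ∧
                N₂ (T v - T w) ≤ (1 + C * ε) * N₁ (v - w)) ∧
              ∀ v, N₁ (v - x₁) ≤ r → N₂ (φ v - T v) ≤ ε * r := by
  refine ⟨1, le_rfl, fun n ε hε _ => ?_⟩
  obtain ⟨δ, hδ0, hδ1, H⟩ := GHA_near_linear_of_norm_le n hε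
  refine ⟨δ, hδ0, hδ1, fun N₁ N₂ hN₁ hN₂ x₁ x₂ r hr φ hmaps hdist honto => ?_⟩
  obtain ⟨A₁, hA₁⟩ := N₁.exists_linearEquiv_norm_le (n := n) (by simp) hN₁
  obtain ⟨A₂, hA₂⟩ := N₂.exists_linearEquiv_norm_le (n := n) (by simp) hN₂
  let M₁ : Seminorm ℝ (Fin n → ℝ) := N₁.comp A₁.toLinearMap
  let M₂ : Seminorm ℝ (Fin n → ℝ) := N₂.comp A₂.toLinearMap
  let p : (Fin n → ℝ) → (Fin n → ℝ) := fun v => x₁ + r • A₁ v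
  let q : (Fin n → ℝ) → (Fin n → ℝ) := fun v => x₂ + r • A₂ v
  let ψ : (Fin n → ℝ) → (Fin n → ℝ) := fun v => A₂.symm (r⁻¹ • (φ (p v) - x₂))
  have hscale : ∀ (N : Seminorm ℝ (Fin n → ℝ)) (v : Fin n → ℝ), N (r • v) = r * N v := fun N v => by
    rw [map_smul_eq_mul, Real.norm_of_nonneg hr.le]
  have hq : ∀ v, φ (p v) = q (ψ v) := fun v => by
    simp only [q, ψ, LinearEquiv.apply_symm_apply]
    rw [smul_inv_smul₀ hr.ne']; abel
  have hpsub : ∀ v w, N₁ (p v - p w) = r * M₁ (v - w) := fun v w => by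
    change _ = r * N₁ (A₁ (v - w))
    rw [← hscale, map_sub A₁, smul_sub]; simp only [p]; rw [add_sub_add_left_eq_sub]
  have hqsub : ∀ v w, N₂ (q v - q w) = r * M₂ (v - w) := fun v w => by
    change _ = r * N₂ (A₂ (v - w))
    rw [← hscale, map_sub A₂, smul_sub]; simp only [q]; rw [add_sub_add_left_eq_sub]
  have hp0 : p 0 = x₁ := by simp [p]
  have hq0 : q 0 = x₂ := by simp [q]
  have hpball : ∀ v, N₁ (p v - x₁) ≤ r ↔ M₁ v ≤ 1 := fun v => by
    rw [← hp0, hpsub, sub_zero, mul_le_iff_le_one_right hr]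
  have hqball : ∀ v, N₂ (q v - x₂) ≤ r ↔ M₂ v ≤ 1 := fun v => by
    rw [← hq0, hqsub, sub_zero, mul_le_iff_le_one_right hr]
  have hpsurj : ∀ v, ∃ w, p w = v := fun v => ⟨A₁.symm (r⁻¹ • (v - x₁)), by
    simp only [p, LinearEquiv.apply_symm_apply]
    rw [smul_inv_smul₀ hr.ne']; abel⟩
  obtain ⟨T, hT⟩ := H M₁ M₂ hA₁ hA₂ ψ
    (fun v hv => by
      rw [← hqball, ← hq]
      exact hmaps _ ((hpball v).2 hv))
    (fun v w hv hw => by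
      have h := hdist _ _ ((hpball v).2 hv) ((hpball w).2 hw)
      rw [hq, hq, hpsub, hqsub, ← mul_sub, abs_mul, abs_of_pos hr, mul_comm δ] at h
      exact le_of_mul_le_mul_left h hr)
    (fun u hu => by
      obtain ⟨v, hv, h⟩ := honto _ ((hqball u).2 hu)
      obtain ⟨w, rfl⟩ := hpsurj v
      rw [hq, hqsub, mul_comm δ] at h
      exact ⟨w, (hpball w).1 hv, le_of_mul_le_mul_left h hr⟩)
  let S : (Fin n → ℝ) →ₗ[ℝ] (Fin n → ℝ) := A₂.toLinearMap ∘ₗ T ∘ₗ A₁.symm.toLinearMap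
  let T' : (Fin n → ℝ) →ᵃ[ℝ] (Fin n → ℝ) := S.toAffineMap + AffineMap.const ℝ _ (x₂ - S x₁)
  have hT' : ∀ v, T' (p v) = q (T v) := fun v => by
    change S (x₁ + r • A₁ v) + (x₂ - S x₁) = x₂ + r • A₂ (T v)
    have : S (A₁ v) = A₂ (T v) := by simp [S]
    rw [map_add, map_smul, this]; abel
  refine ⟨T', fun v w => ?_, fun v hv => ?_⟩
  · obtain ⟨v, rfl⟩ := hpsurj v
    obtain ⟨w, rfl⟩ := hpsurj w
    rw [hT', hT', hqsub, hpsub, ← map_sub]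
    have h := abs_le.1 (hT (v - w)).1
    constructor
    · nlinarith [h.1]
    · nlinarith [h.2]
  · obtain ⟨v, rfl⟩ := hpsurj v
    rw [hT', hq, hqsub, mul_comm ε]
    exact mul_le_mul_of_nonneg_left ((hT v).2 ((hpball v).1 hv)) hr.le
end
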